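/- arXiv:1903.04672 — 2 statements merged into one kernel-verified Lean document; each statement's English description precedes it below -/
import Mathlib

section
/- Let G be a finite group acting on a finite nonempty set Ω with N distinct orbits. Define the Burnside-process transition matrix B on Ω by B(x,y) = (1/|Stab(x)|) · ∑_{g ∈ Stab(x), g·y = y} 1/|Fix(g)|, where Stab(x) = {g ∈ G | g·x = x} and Fix(g) = {z ∈ Ω | g·z = z}. Then the uniform orbit distribution π(x) = 1/(N·|orb(x)|) is stationary for B: ∑_{x ∈ Ω} π(x)·B(x,y) = π(y) for all y ∈ Ω. -/
open scoped Classical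

/-- Orbit-stabilizer over the reals, as a formula for the reciprocal of the orbit size. -/
theorem inv_ncard_orbit_eq {G Ω : Type*} [Group G] [Finite G] [MulAction G Ω] (x : Ω) :
    ((MulAction.orbit G x).ncard : ℝ)⁻¹
      = (Nat.card (MulAction.stabilizer G x) : ℝ) / (Nat.card G : ℝ) := by
  have h : ((MulAction.orbit G x).ncard : ℝ) * (Nat.card (MulAction.stabilizer G x) : ℝ)
      = (Nat.card G : ℝ) := by
    rw [← MulAction.index_stabilizer, mul_comm]
    exact_mod_cast (MulAction.stabilizer G x).card_mul_index
  have hS : (Nat.card (MulAction.stabilizer G x) : ℝ) ≠ 0 := by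
    exact_mod_cast Nat.card_pos.ne'
  rw [← h, div_mul_cancel_right₀ hS]

/-- Averaging uniformly over the fixed points of `g`, summed over all `g` fixing `y`,
counts the stabilizer of `y`. -/
theorem sum_sum_inv_ncard_fixed {G Ω : Type*} [Group G] [Fintype G] [Fintype Ω]
    [MulAction G Ω] (y : Ω) :
    ∑ x : Ω, ∑ g ∈ Finset.univ.filter (fun g : G => g • x = x ∧ g • y = y),
        (1 / (({z : Ω | g • z = z}).ncard : ℝ))
      = (Nat.card (MulAction.stabilizer G y) : ℝ) := by
  have hfix (g : G) (hg : g • y = y) :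
      (({z : Ω | g • z = z}).ncard : ℝ) ≠ 0 := by
    exact_mod_cast Set.ncard_ne_zero_of_mem (s := {z : Ω | g • z = z}) hg
  have hinner (g : G) :
      ∑ x : Ω, (if g • x = x ∧ g • y = y then 1 / (({z : Ω | g • z = z}).ncard : ℝ) else 0)
        = if g • y = y then 1 else 0 := by
    by_cases hg : g • y = y
    · simp only [hg, and_true, if_true]
      rw [← Finset.sum_filter, Finset.sum_const, nsmul_eq_mul,
        Set.ncard_eq_toFinset_card', Set.toFinset_ofPred, mul_one_div, div_self]
      simpa only [Set.ncard_eq_toFinset_card', Set.toFinset_ofPred] using hfix g hg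
    · simp [hg]
  simp_rw [Finset.sum_filter]
  rw [Finset.sum_comm, Finset.sum_congr rfl fun g _ => hinner g, Finset.sum_boole,
    Nat.card_eq_fintype_card]
  simp [Fintype.card_subtype, MulAction.mem_stabilizer_iff]

/-- The uniform orbit distribution `π x = 1 / (N * |orb x|)` is stationary for
the Burnside-process transition matrix
`B x y = (1 / |Stab x|) * ∑_{g ∈ Stab x, g • y = y} 1 / |Fix g|`. -/
theorem burnside_process_stationary
    {G Ω : Type*} [Group G] [Fintype G] [Fintype Ω] [Nonempty Ω] [MulAction G Ω]
    (N : ℕ) (hN : N = Nat.card (Quotient (MulAction.orbitRel G Ω)))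
    (B : Ω → Ω → ℝ)
    (hB : ∀ x y : Ω,
      B x y = (1 / (Nat.card (MulAction.stabilizer G x) : ℝ)) *
        ∑ g ∈ Finset.univ.filter (fun g : G => g • x = x ∧ g • y = y),
          (1 / (({z : Ω | g • z = z}).ncard : ℝ))) :
    ∀ y : Ω,
      (∑ x : Ω, (1 / ((N : ℝ) * ((MulAction.orbit G x).ncard : ℝ))) * B x y)
        = 1 / ((N : ℝ) * ((MulAction.orbit G y).ncard : ℝ)) := by
  intro y
  have hS (x : Ω) : (Nat.card (MulAction.stabilizer G x) : ℝ) ≠ 0 := by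
    exact_mod_cast Nat.card_pos.ne'
  have hterm (x : Ω) :
      (1 / ((N : ℝ) * ((MulAction.orbit G x).ncard : ℝ))) * B x y
        = (N : ℝ)⁻¹ * (Nat.card G : ℝ)⁻¹ *
          ∑ g ∈ Finset.univ.filter (fun g : G => g • x = x ∧ g • y = y),
            (1 / (({z : Ω | g • z = z}).ncard : ℝ)) := by
    rw [hB, one_div, mul_inv, inv_ncard_orbit_eq, ← mul_assoc]
    congr 1
    rw [one_div, div_eq_mul_inv, mul_assoc, mul_right_comm, mul_inv_cancel₀ (hS x), one_mul]
  rw [Finset.sum_congr rfl fun x _ => hterm x, ← Finset.mul_sum, sum_sum_inv_ncard_fixed,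
    one_div, mul_inv, inv_ncard_orbit_eq, div_eq_mul_inv]
  ring
end

section
/- Let G be a finite group acting on a finite nonempty set Ω with N distinct orbits, and let Pr : Ω → ℝ be a strictly positive G-invariant probability mass function. Define the orbit-jump Metropolis transition matrix P on Ω by P(x,y) = (1/(N·|orb(y)|)) · min(1, (Pr(y)·|orb(y)|)/(Pr(x)·|orb(x)|)) for y ≠ x, and P(x,x) = 1 − ∑_{y ≠ x} P(x,y). Then for every starting state x ∈ Ω and every natural number t, the total variation distance of the t-step distribution from Pr satisfies (1/2)∑_{y ∈ Ω} |P^t(x,y) − Pr(y)| ≤ ((N−1)/N)^t. -/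
open Finset in
/-- One step of a stochastic matrix satisfying the minorization `ε * π y ≤ P z y` contracts the
`ℓ¹` distance to its stationary distribution `π` by the factor `1 - ε`. -/
lemma sum_abs_vecMul_sub_le_of_minorization {Ω : Type*} [Fintype Ω]
    {P : Matrix Ω Ω ℝ} {π μ : Ω → ℝ} {ε : ℝ} (hrow : ∀ x, ∑ y, P x y = 1)
    (hπ : ∑ x, π x = 1) (hstat : ∀ y, ∑ x, π x * P x y = π y)
    (hmin : ∀ x y, ε * π y ≤ P x y) (hμ : ∑ x, μ x = 1) :
    ∑ y, |∑ z, μ z * P z y - π y| ≤ (1 - ε) * ∑ z, |μ z - π z| := by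
  have hstep (y : Ω) :
      |∑ z, μ z * P z y - π y| ≤ ∑ z, |μ z - π z| * (P z y - ε * π y) := by
    have heq : ∑ z, μ z * P z y - π y = ∑ z, (μ z - π z) * (P z y - ε * π y) := by
      have hzero : ∑ z, (μ z - π z) * (ε * π y) = 0 := by
        rw [← sum_mul, sum_sub_distrib, hμ, hπ, sub_self, zero_mul]
      simp only [mul_sub (_ - _), sum_sub_distrib, hzero, sub_mul _ _ (P _ _), hstat, sub_zero]
    rw [heq]
    refine (abs_sum_le_sum_abs _ _).trans_eq (sum_congr rfl fun z _ => ?_)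
    rw [abs_mul, abs_of_nonneg (sub_nonneg.2 (hmin z y))]
  refine (sum_le_sum fun y _ => hstep y).trans_eq ?_
  rw [sum_comm, mul_sum]
  refine sum_congr rfl fun z _ => ?_
  rw [← mul_sum, sum_sub_distrib, hrow, ← mul_sum, hπ, mul_one, mul_comm]

open Finset in
/-- Doeblin's bound: under a minorization by `ε` times its stationary distribution, a finite
Markov chain converges in total variation at the geometric rate `1 - ε`. -/
lemma half_sum_abs_pow_sub_le_of_minorization {Ω : Type*} [Fintype Ω] [DecidableEq Ω]
    {P : Matrix Ω Ω ℝ} {π : Ω → ℝ} {ε : ℝ} (hε : ε ≤ 1) (hrow : ∀ x, ∑ y, P x y = 1)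
    (hπ0 : ∀ x, 0 ≤ π x) (hπ : ∑ x, π x = 1) (hstat : ∀ y, ∑ x, π x * P x y = π y)
    (hmin : ∀ x y, ε * π y ≤ P x y) (x : Ω) (t : ℕ) :
    (1 / 2) * ∑ y, |(P ^ t) x y - π y| ≤ (1 - ε) ^ t := by
  have hrow_pow (t : ℕ) : ∑ y, (P ^ t) x y = 1 := by
    induction t with
    | zero => simp [Matrix.one_apply]
    | succ t ih =>
      simp only [pow_succ, Matrix.mul_apply]
      rw [sum_comm]
      simp only [← mul_sum, hrow, mul_one, ih]
  induction t with
  | zero =>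
    have hle : ∑ y, |(P ^ 0) x y - π y| ≤ ∑ y, ((1 : Matrix Ω Ω ℝ) x y + π y) := by
      refine sum_le_sum fun y _ => (abs_sub _ _).trans_eq ?_
      rw [abs_of_nonneg (hπ0 y), pow_zero, Matrix.one_apply]
      split_ifs <;> simp
    have hone : ∑ y, (1 : Matrix Ω Ω ℝ) x y = 1 := hrow_pow 0
    rw [sum_add_distrib, hπ, hone] at hle
    rw [pow_zero (1 - ε)]
    linarith
  | succ t ih =>
    have hstep := sum_abs_vecMul_sub_le_of_minorization hrow hπ hstat hmin (hrow_pow t)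
    have hmul := mul_le_mul_of_nonneg_left ih (sub_nonneg.2 hε)
    rw [pow_succ' (1 - ε), pow_succ P]
    simp only [Matrix.mul_apply]
    linarith

/-- The reciprocals of the orbit sizes sum to the number of orbits. -/
lemma MulAction.sum_inv_ncard_orbit (G : Type*) {Ω : Type*} [Group G] [Fintype Ω]
    [MulAction G Ω] :
    ∑ y : Ω, ((MulAction.orbit G y).ncard : ℝ)⁻¹ =
      Nat.card (Quotient (MulAction.orbitRel G Ω)) := by
  classical
  rw [Nat.card_eq_fintype_card,
    ← Finset.sum_fiberwise Finset.univ (Quotient.mk (MulAction.orbitRel G Ω))]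
  rw [← Finset.card_univ, Finset.cast_card]
  refine Finset.sum_congr rfl fun q _ => ?_
  induction q using Quotient.inductionOn with | _ x
  have hmem (y : Ω) : Quotient.mk (MulAction.orbitRel G Ω) y = Quotient.mk _ x ↔
      y ∈ MulAction.orbit G x := by
    rw [Quotient.eq, MulAction.orbitRel_apply]
  have hcard : (MulAction.orbit G x).ncard = (Finset.univ.filter fun y : Ω =>
      Quotient.mk (MulAction.orbitRel G Ω) y = Quotient.mk _ x).card := by
    rw [← Set.ncard_coe_finset]
    congr 1
    ext y
    simp [hmem]
  have hne : ((MulAction.orbit G x).ncard : ℝ) ≠ 0 :=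
    Nat.cast_ne_zero.2 ((Set.ncard_pos (Set.toFinite _)).2 (MulAction.nonempty_orbit x)).ne'
  rw [Finset.sum_congr rfl fun y hy => by
    rw [MulAction.orbit_eq_iff.2 ((hmem y).1 (Finset.mem_filter.1 hy).2)]]
  rw [Finset.sum_const, ← hcard, nsmul_eq_mul, mul_inv_cancel₀ hne]

/-- An invariant probability mass function gives each point at most the reciprocal of its
orbit size. -/
lemma MulAction.mul_ncard_orbit_le_one {G Ω : Type*} [Group G] [Fintype Ω] [MulAction G Ω]
    {p : Ω → ℝ} (hp : ∀ x, 0 ≤ p x) (hsum : ∑ x, p x = 1)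
    (hinv : ∀ (g : G) (x : Ω), p (g • x) = p x) (x : Ω) :
    p x * ((MulAction.orbit G x).ncard : ℝ) ≤ 1 := by
  classical
  have hconst : ∑ y ∈ (MulAction.orbit G x).toFinset, p y =
      p x * ((MulAction.orbit G x).ncard : ℝ) := by
    rw [Finset.sum_congr rfl (g := fun _ => p x), Finset.sum_const, nsmul_eq_mul,
      Set.ncard_eq_toFinset_card', mul_comm]
    intro y hy
    obtain ⟨g, rfl⟩ := Set.mem_toFinset.1 hy
    exact hinv g x
  rw [← hconst, ← hsum]
  exact Finset.sum_le_univ_sum_of_nonneg hp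

/-- Mixing bound for orbit-jump MCMC: For the orbit-jump Metropolis
transition matrix `P` with respect to a strictly positive `G`-invariant pmf `Pr` on a
finite set `Ω` with `N` orbits, for every starting state `x` and every `t`, the total
variation distance of the `t`-step distribution from `Pr` is at most `((N-1)/N)^t`. -/
theorem orbit_jump_mixing_bound
    {G Ω : Type*} [Group G] [Fintype G] [Fintype Ω] [DecidableEq Ω] [Nonempty Ω]
    [MulAction G Ω]
    (N : ℕ) (hN : N = Nat.card (Quotient (MulAction.orbitRel G Ω)))
    (Pr : Ω → ℝ) (hpos : ∀ x, 0 < Pr x) (hsum : ∑ x : Ω, Pr x = 1)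
    (hinv : ∀ (g : G) (x : Ω), Pr (g • x) = Pr x)
    (P : Matrix Ω Ω ℝ)
    (hPne : ∀ x y : Ω, y ≠ x →
      P x y = (1 / ((N : ℝ) * ((MulAction.orbit G y).ncard : ℝ))) *
        min 1 ((Pr y * ((MulAction.orbit G y).ncard : ℝ)) /
               (Pr x * ((MulAction.orbit G x).ncard : ℝ))))
    (hPdiag : ∀ x : Ω, P x x = 1 - ∑ y ∈ Finset.univ.filter (fun y => y ≠ x), P x y) :
    ∀ (x : Ω) (t : ℕ),
      (1 / 2) * ∑ y : Ω, |(P ^ t) x y - Pr y| ≤ (((N : ℝ) - 1) / (N : ℝ)) ^ t := by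
  classical
  intro x t
  have hn (y : Ω) : (0 : ℝ) < (MulAction.orbit G y).ncard :=
    Nat.cast_pos.2 ((Set.ncard_pos (Set.toFinite _)).2 (MulAction.nonempty_orbit y))
  have hN1 : (1 : ℝ) ≤ N := by
    have : Nonempty (Quotient (MulAction.orbitRel G Ω)) := ⟨Quotient.mk _ x⟩
    rw [hN]
    exact_mod_cast Nat.one_le_iff_ne_zero.2 Nat.card_pos.ne'
  have hN0 : (0 : ℝ) < N := by linarith
  have hle := MulAction.mul_ncard_orbit_le_one (fun x => (hpos x).le) hsum hinv
  have hdiag (x : Ω) : P x x + ∑ y ∈ Finset.univ.filter (fun y => y ≠ x), P x y = 1 := by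
    rw [hPdiag x, sub_add_cancel]
  have hsplit (f : Ω → ℝ) (x : Ω) :
      ∑ y, f y = f x + ∑ y ∈ Finset.univ.filter (fun y => y ≠ x), f y := by
    rw [Finset.filter_ne', Finset.add_sum_erase _ _ (Finset.mem_univ x)]
  have hrow (x : Ω) : ∑ y, P x y = 1 := (hsplit (P x) x).trans (hdiag x)
  have hbalance (x y : Ω) : Pr x * P x y = Pr y * P y x := by
    by_cases hxy : y = x
    · rw [hxy]
    have hform (u v : Ω) (huv : v ≠ u) : Pr u * P u v =
        min (Pr u * (MulAction.orbit G u).ncard) (Pr v * (MulAction.orbit G v).ncard) /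
          (N * (MulAction.orbit G u).ncard * (MulAction.orbit G v).ncard) := by
      have hu := hn u
      have hv := hn v
      have hpu := hpos u
      have hA : 0 < Pr u * (MulAction.orbit G u).ncard := mul_pos hpu hu
      have hmin : min (Pr u * ((MulAction.orbit G u).ncard : ℝ))
          (Pr v * (MulAction.orbit G v).ncard) = Pr u * (MulAction.orbit G u).ncard *
          min 1 (Pr v * (MulAction.orbit G v).ncard / (Pr u * (MulAction.orbit G u).ncard)) := by
        rw [mul_min_of_nonneg _ _ hA.le, mul_one, mul_div_cancel₀ _ hA.ne']
      rw [hPne u v huv, hmin]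
      field_simp
    rw [hform x y hxy, hform y x (Ne.symm hxy), min_comm, mul_right_comm]
  have hstat (y : Ω) : ∑ x, Pr x * P x y = Pr y := by
    simp only [fun x => hbalance x y, ← Finset.mul_sum, hrow, mul_one]
  have hmin (x y : Ω) : 1 / (N : ℝ) * Pr y ≤ P x y := by
    have hy : Pr y ≤ ((MulAction.orbit G y).ncard : ℝ)⁻¹ := by
      rw [← one_div, le_div_iff₀ (hn y)]
      exact hle y
    by_cases hxy : y = x
    · subst hxy
      have hoff : ∑ z ∈ Finset.univ.filter (fun z => z ≠ y), P y z ≤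
          ∑ z ∈ Finset.univ.filter (fun z => z ≠ y),
            1 / (N : ℝ) * ((MulAction.orbit G z).ncard : ℝ)⁻¹ := by
        refine Finset.sum_le_sum fun z hz => ?_
        rw [hPne y z (Finset.mem_filter.1 hz).2, ← one_div ((_ : ℕ) : ℝ), one_div_mul_one_div]
        exact mul_le_of_le_one_right (by have := hn z; positivity) (min_le_left _ _)
      have htot := hsplit (fun z => 1 / (N : ℝ) * ((MulAction.orbit G z).ncard : ℝ)⁻¹) y
      rw [← Finset.mul_sum, MulAction.sum_inv_ncard_orbit, ← hN, one_div_mul_cancel hN0.ne']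
        at htot
      have := mul_le_mul_of_nonneg_left hy (one_div_pos.2 hN0).le
      linarith [hdiag y]
    · have hA : 0 < Pr x * (MulAction.orbit G x).ncard := mul_pos (hpos x) (hn x)
      have hB : 0 < Pr y * (MulAction.orbit G y).ncard := mul_pos (hpos y) (hn y)
      have hacc : Pr y * (MulAction.orbit G y).ncard ≤
          min 1 (Pr y * (MulAction.orbit G y).ncard / (Pr x * (MulAction.orbit G x).ncard)) :=
        le_min (hle y) (le_div_self hB.le hA (hle x))
      have hny := hn y
      rw [hPne x y hxy]
      calc 1 / (N : ℝ) * Pr y = 1 / (N * (MulAction.orbit G y).ncard) *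
            (Pr y * (MulAction.orbit G y).ncard) := by field_simp
        _ ≤ _ := mul_le_mul_of_nonneg_left hacc (by positivity)
  have hrate : ((N : ℝ) - 1) / N = 1 - 1 / N := by
    rw [sub_div, div_self hN0.ne']
  rw [hrate]
  exact half_sum_abs_pow_sub_le_of_minorization ((div_le_one hN0).2 hN1) hrow
    (fun x => (hpos x).le) hsum hstat hmin x t
end
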